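/- For every integer i ≥ 1 and every K ≥ 1 there exists a constant C = C(i,K) > 0 such that the following holds. Let Γ be a finite group with |Γ| ≥ 2, and let S ⊆ S' be symmetric generating sets of Γ with S' ⊆ Sⁱ := {s₁s₂⋯sᵢ : s₁,…,sᵢ ∈ S} and |S'| ≤ K·|S|. Then the total variation mixing times of the lazy simple random walks satisfy mix(Cay(Γ,S')) ≤ C · mix(Cay(Γ,S)) · log|Γ|. -/

import Mathlib

open Finset

/-- A symmetric generating set of a group: does not contain the identity, is closed under
inverses, and generates the group. -/
def IsSymmGen {G : Type*} [Group G] (S : Finset G) : Prop :=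
  (1 : G) ∉ S ∧ (∀ s ∈ S, s⁻¹ ∈ S) ∧ Subgroup.closure (S : Set G) = ⊤

/-- The set `Sⁱ` of products of exactly `i` elements of `S`. -/
def prodPow {G : Type*} [Group G] (S : Finset G) (i : ℕ) : Set G :=
  {g : G | ∃ l : List G, l.length = i ∧ (∀ s ∈ l, s ∈ S) ∧ l.prod = g}

/-- Transition matrix of the lazy simple random walk on the Cayley graph `Cay(G,S)`:
`P(g,g) = 1/2` and `P(g,gs) = 1/(2|S|)` for `s ∈ S`. -/
noncomputable def lazyCayleyP {G : Type*} [Group G] [Fintype G] [DecidableEq G]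
    (S : Finset G) : Matrix G G ℝ :=
  fun g h => if h = g then 1 / 2 else if g⁻¹ * h ∈ S then 1 / (2 * (S.card : ℝ)) else 0

/-- Total variation mixing time of a discrete-time chain with transition matrix `P` whose
stationary distribution is uniform. -/
noncomputable def tvMixUnif {G : Type*} [Fintype G] [DecidableEq G] (P : Matrix G G ℝ) : ℕ :=
  sInf {t : ℕ | ∀ x : G, (∑ y : G, |(P ^ t) x y - 1 / (Fintype.card G : ℝ)|) / 2 ≤ 1 / 4}

open Matrix
set_option linter.unusedSectionVars false

section Helpers

variable {G : Type} [Group G] [Fintype G] [DecidableEq G]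

/-- Unnormalised Dirichlet form. -/
noncomputable def dirF (S : Finset G) (f : G → ℝ) : ℝ :=
  ∑ x, ∑ s ∈ S, (f (x * s) - f x) ^ 2

theorem sum_trans (f : G → ℝ) (s : G) : ∑ x, f (x * s) = ∑ x, f x :=
  Equiv.sum_comp (Equiv.mulRight s) f

theorem lazy_mulVec (S : Finset G) (h1 : (1 : G) ∉ S) (f : G → ℝ) (x : G) :
    (lazyCayleyP S *ᵥ f) x = f x / 2 + (∑ s ∈ S, f (x * s)) / (2 * (S.card : ℝ)) := by
  have e1 : (lazyCayleyP S *ᵥ f) x = ∑ g, lazyCayleyP S x (x * g) * f (x * g) := by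
    simp only [Matrix.mulVec, dotProduct]
    exact (Equiv.sum_comp (Equiv.mulLeft x) (fun y => lazyCayleyP S x y * f y)).symm
  have e2 : ∀ g, lazyCayleyP S x (x * g) * f (x * g) =
      (if g = 1 then f x / 2 else 0) +
        (if g ∈ S then f (x * g) / (2 * (S.card : ℝ)) else 0) := by
    intro g
    by_cases hg : g = 1
    · subst hg
      simp [lazyCayleyP, h1]
      ring
    · by_cases hS : g ∈ S
      · simp [lazyCayleyP, hg, hS]
        ring
      · simp [lazyCayleyP, hg, hS]
  rw [e1, Finset.sum_congr rfl (fun g _ => e2 g), Finset.sum_add_distrib]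
  simp [Finset.sum_ite_mem, Finset.sum_div]

theorem lazy_symm (S : Finset G) (h : IsSymmGen S) : (lazyCayleyP S)ᵀ = lazyCayleyP S := by
  ext x y
  simp only [Matrix.transpose_apply, lazyCayleyP]
  have : y⁻¹ * x ∈ S ↔ x⁻¹ * y ∈ S := by
    constructor
    · intro hh; simpa using h.2.1 _ hh
    · intro hh; simpa using h.2.1 _ hh
  simp [this, eq_comm]

theorem lazy_quad (S : Finset G) (h : IsSymmGen S) (hc : 0 < S.card) (f : G → ℝ) :
    f ⬝ᵥ (lazyCayleyP S *ᵥ f) = f ⬝ᵥ f - dirF S f / (4 * (S.card : ℝ)) ∧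
    f ⬝ᵥ (lazyCayleyP S *ᵥ f) =
      (∑ x, ∑ s ∈ S, (f (x * s) + f x) ^ 2) / (4 * (S.card : ℝ)) := by
  have hc' : (S.card : ℝ) ≠ 0 := by positivity
  have key : f ⬝ᵥ (lazyCayleyP S *ᵥ f) =
      (f ⬝ᵥ f) / 2 + (∑ x, ∑ s ∈ S, f x * f (x * s)) / (2 * (S.card : ℝ)) := by
    simp only [dotProduct, lazy_mulVec S h.1]
    rw [Finset.sum_div, Finset.sum_div, ← Finset.sum_add_distrib]
    refine Finset.sum_congr rfl fun x _ => ?_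
    rw [← Finset.mul_sum]; ring
  have q1 : ∑ x, ∑ s ∈ S, (f (x * s)) ^ 2 = S.card * (f ⬝ᵥ f) := by
    rw [Finset.sum_comm]
    rw [Finset.sum_congr rfl (fun s _ => sum_trans (fun x => f x ^ 2) s)]
    simp [dotProduct, sq]
  have q2 : ∑ x, ∑ s ∈ S, (f x) ^ 2 = S.card * (f ⬝ᵥ f) := by
    simp [dotProduct, sq, Finset.mul_sum]
  have d1 : dirF S f = 2 * S.card * (f ⬝ᵥ f) - 2 * ∑ x, ∑ s ∈ S, f x * f (x * s) := by
    have : dirF S f = ∑ x, ∑ s ∈ S, (f (x * s)) ^ 2 + ∑ x, ∑ s ∈ S, (f x) ^ 2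
        - 2 * ∑ x, ∑ s ∈ S, f x * f (x * s) := by
      simp only [dirF, Finset.mul_sum, ← Finset.sum_add_distrib, ← Finset.sum_sub_distrib]
      refine Finset.sum_congr rfl fun x _ => Finset.sum_congr rfl fun s _ => ?_
      ring
    rw [this, q1, q2]; ring
  have d2 : ∑ x, ∑ s ∈ S, (f (x * s) + f x) ^ 2
      = 2 * S.card * (f ⬝ᵥ f) + 2 * ∑ x, ∑ s ∈ S, f x * f (x * s) := by
    have : ∑ x, ∑ s ∈ S, (f (x * s) + f x) ^ 2
        = ∑ x, ∑ s ∈ S, (f (x * s)) ^ 2 + ∑ x, ∑ s ∈ S, (f x) ^ 2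
        + 2 * ∑ x, ∑ s ∈ S, f x * f (x * s) := by
      simp only [Finset.mul_sum, ← Finset.sum_add_distrib]
      refine Finset.sum_congr rfl fun x _ => Finset.sum_congr rfl fun s _ => ?_
      ring
    rw [this, q1, q2]; ring
  constructor
  · rw [key, d1]; field_simp; ring
  · rw [key, d2]; field_simp; ring

theorem psd_of (M : Matrix G G ℝ) (hs : Mᵀ = M) (h : ∀ f : G → ℝ, 0 ≤ f ⬝ᵥ (M *ᵥ f)) :
    M.PosSemidef := by
  refine Matrix.PosSemidef.of_dotProduct_mulVec_nonneg ?_ ?_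
  · rw [Matrix.IsHermitian, Matrix.conjTranspose_eq_transpose_of_trivial, hs]
  · intro f; simpa using h f

theorem psd_quad {M : Matrix G G ℝ} (h : M.PosSemidef) (f : G → ℝ) : 0 ≤ f ⬝ᵥ (M *ᵥ f) := by
  simpa using h.dotProduct_mulVec_nonneg f

theorem lazy_psd (S : Finset G) (h : IsSymmGen S) (hc : 0 < S.card) :
    (lazyCayleyP S).PosSemidef := by
  refine psd_of _ (lazy_symm S h) fun f => ?_
  rw [(lazy_quad S h hc f).2]
  positivity

theorem dirF_nonneg (S : Finset G) (f : G → ℝ) : 0 ≤ dirF S f := by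
  unfold dirF; positivity

theorem lazy_quad_sub (S : Finset G) (h : IsSymmGen S) (hc : 0 < S.card) (f : G → ℝ) :
    f ⬝ᵥ ((1 - lazyCayleyP S) *ᵥ f) = dirF S f / (4 * (S.card : ℝ)) := by
  rw [Matrix.sub_mulVec, Matrix.one_mulVec, dotProduct_sub, (lazy_quad S h hc f).1]; ring

theorem lazy_psd' (S : Finset G) (h : IsSymmGen S) (hc : 0 < S.card) :
    (1 - lazyCayleyP S).PosSemidef := by
  refine psd_of _ (by rw [Matrix.transpose_sub, lazy_symm S h, Matrix.transpose_one]) fun f => ?_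
  rw [lazy_quad_sub S h hc f]
  have := dirF_nonneg S f
  positivity

theorem sandwich {A B : Matrix G G ℝ} (hA : A.PosSemidef) (hB : B.PosSemidef) :
    (A * B * A).PosSemidef := by
  have := hB.conjTranspose_mul_mul_same A
  rwa [hA.isHermitian.eq] at this

theorem psd_pow_gap {P : Matrix G G ℝ} (hP : P.PosSemidef) (hQ : (1 - P).PosSemidef) (t : ℕ) :
    ((1 - P ^ t) * (1 - P)).PosSemidef := by
  induction t with
  | zero => simpa using Matrix.PosSemidef.zero
  | succ t ih =>
    have e : (1 - P ^ (t + 1)) * (1 - P) = (1 - P ^ t) * (1 - P) + (1 - P) * P ^ t * (1 - P) := by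
      rw [pow_succ']
      noncomm_ring
    rw [e]
    exact ih.add (sandwich hQ (hP.pow t))

theorem psd_linear {P : Matrix G G ℝ} (hP : P.PosSemidef) (hQ : (1 - P).PosSemidef) (t : ℕ) :
    ((t : ℝ) • (1 - P) - (1 - P ^ t)).PosSemidef := by
  induction t with
  | zero => simpa using Matrix.PosSemidef.zero
  | succ t ih =>
    have e : ((t + 1 : ℕ) : ℝ) • (1 - P) - (1 - P ^ (t + 1))
        = ((t : ℝ) • (1 - P) - (1 - P ^ t)) + (1 - P ^ t) * (1 - P) := by
      push_cast
      rw [add_smul, one_smul, pow_succ]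
      noncomm_ring
    rw [e]
    exact ih.add (psd_pow_gap hP hQ t)

theorem schur (M : Matrix G G ℝ) (hs : Mᵀ = M) (c : ℝ) (hc : ∀ x, ∑ y, |M x y| ≤ c)
    (f : G → ℝ) : f ⬝ᵥ (M *ᵥ f) ≤ c * (f ⬝ᵥ f) := by
  have hs' : ∀ x y, M x y = M y x := fun x y => congrFun (congrFun hs.symm x) y
  have e1 : f ⬝ᵥ (M *ᵥ f) ≤ ∑ x, ∑ y, (|M x y| * f x ^ 2 / 2 + |M x y| * f y ^ 2 / 2) := by
    simp only [dotProduct, Matrix.mulVec, Finset.mul_sum]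
    refine Finset.sum_le_sum fun x _ => Finset.sum_le_sum fun y _ => ?_
    have h1 : f x * (M x y * f y) ≤ |M x y| * (|f x| * |f y|) := by
      refine (le_abs_self _).trans (le_of_eq ?_)
      rw [abs_mul, abs_mul]; ring
    have h2 : |f x| * |f y| ≤ f x ^ 2 / 2 + f y ^ 2 / 2 := by
      rw [← sq_abs (f x), ← sq_abs (f y)]
      nlinarith [sq_nonneg (|f x| - |f y|)]
    have := mul_le_mul_of_nonneg_left h2 (abs_nonneg (M x y))
    linarith
  have e2 : ∑ x, ∑ y, |M x y| * f y ^ 2 / 2 = ∑ x, ∑ y, |M x y| * f x ^ 2 / 2 := by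
    rw [Finset.sum_comm]
    refine Finset.sum_congr rfl fun x _ => Finset.sum_congr rfl fun y _ => ?_
    rw [hs' x y]
  have e3 : ∑ x, ∑ y, |M x y| * f x ^ 2 / 2 ≤ c * (f ⬝ᵥ f) / 2 := by
    simp only [dotProduct, Finset.mul_sum, Finset.sum_div]
    refine Finset.sum_le_sum fun x _ => ?_
    rw [← Finset.sum_div, ← Finset.sum_mul]
    have := mul_le_mul_of_nonneg_right (hc x) (sq_nonneg (f x))
    nlinarith
  simp only [Finset.sum_add_distrib] at e1
  rw [e2] at e1
  linarith

/-- Mean-zero gap statement. -/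
def HasGap (P : Matrix G G ℝ) (γ : ℝ) : Prop :=
  ∀ f : G → ℝ, ∑ x, f x = 0 → γ * (f ⬝ᵥ f) ≤ f ⬝ᵥ ((1 - P) *ᵥ f)

theorem gap_of_mix {P : Matrix G G ℝ} (hP : P.PosSemidef) (hQ : (1 - P).PosSemidef) (t : ℕ)
    (ht : 0 < t)
    (hm : ∀ x : G, (∑ y : G, |(P ^ t) x y - 1 / (Fintype.card G : ℝ)|) / 2 ≤ 1 / 4) :
    HasGap P (1 / (2 * t)) := by
  intro f hf
  have h1 := psd_quad (psd_linear hP hQ t) f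
  have hsy : (P ^ t)ᵀ = P ^ t := by
    have := (hP.pow t).isHermitian
    rwa [Matrix.IsHermitian, Matrix.conjTranspose_eq_transpose_of_trivial] at this
  have h2 := schur (P ^ t - Matrix.of fun _ _ => 1 / (Fintype.card G : ℝ))
    (by rw [Matrix.transpose_sub, hsy]; rfl) (1 / 2)
    (fun x => by simp only [Matrix.sub_apply, Matrix.of_apply]; linarith [hm x]) f
  have h3 : (Matrix.of fun _ _ => 1 / (Fintype.card G : ℝ) : Matrix G G ℝ) *ᵥ f = 0 := by
    ext x
    simp only [Matrix.mulVec, dotProduct, Matrix.of_apply, ← Finset.mul_sum, hf]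
    simp
  rw [Matrix.sub_mulVec, h3, sub_zero] at h2
  rw [Matrix.sub_mulVec, Matrix.smul_mulVec, dotProduct_sub, dotProduct_smul,
    Matrix.sub_mulVec 1 (P ^ t), Matrix.one_mulVec, dotProduct_sub, smul_eq_mul] at h1
  have ht' : (0 : ℝ) < t := by exact_mod_cast ht
  rw [div_mul_eq_mul_div, div_le_iff₀ (by positivity)]
  linarith

theorem gap_compare (S S' : Finset G) (h : IsSymmGen S) (h' : IsSymmGen S') (hc : 0 < S.card)
    (hsub : S ⊆ S') (K : ℝ) (hK : 1 ≤ K) (hcard : (S'.card : ℝ) ≤ K * (S.card : ℝ)) (γ : ℝ)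
    (hg : HasGap (lazyCayleyP S) γ) : HasGap (lazyCayleyP S') (γ / K) := by
  intro f hf
  have hc' : 0 < S'.card := lt_of_lt_of_le hc (Finset.card_le_card hsub)
  have := hg f hf
  rw [lazy_quad_sub S h hc] at this
  rw [lazy_quad_sub S' h' hc']
  have hK0 : 0 < K := by linarith
  have hcr : (0 : ℝ) < S.card := by exact_mod_cast hc
  have hcr' : (0 : ℝ) < S'.card := by exact_mod_cast hc'
  have hD : dirF S f ≤ dirF S' f := by
    unfold dirF
    refine Finset.sum_le_sum fun x _ => Finset.sum_le_sum_of_subset_of_nonneg hsub ?_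
    intros; positivity
  have hD0 := dirF_nonneg S' f
  rw [div_mul_eq_mul_div, div_le_iff₀ hK0]
  refine this.trans ?_
  rw [div_mul_eq_mul_div, div_le_div_iff₀ (by positivity) (by positivity)]
  have a1 : dirF S f * S'.card ≤ dirF S' f * (K * S.card) := by gcongr
  linarith

theorem gap_exists (S : Finset G) (h : IsSymmGen S) (hc : 0 < S.card) :
    ∃ γ > 0, HasGap (lazyCayleyP S) γ := by
  have hall : ∀ g : G, ∃ c : ℝ, 0 ≤ c ∧
      ∀ f : G → ℝ, ∑ x, (f (x * g) - f x) ^ 2 ≤ c * dirF S f := by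
    intro g
    have hg : g ∈ Subgroup.closure (S : Set G) := by rw [h.2.2]; trivial
    induction hg using Subgroup.closure_induction with
    | mem s hs =>
      refine ⟨1, zero_le_one, fun f => ?_⟩
      rw [one_mul, dirF]
      refine Finset.sum_le_sum fun x _ => ?_
      exact Finset.single_le_sum (f := fun s => (f (x * s) - f x) ^ 2)
        (fun _ _ => sq_nonneg _) hs
    | one => exact ⟨0, le_refl _, fun f => by simp⟩
    | mul a b _ _ iha ihb =>
      obtain ⟨ca, ha0, ha⟩ := iha
      obtain ⟨cb, hb0, hb⟩ := ihb
      refine ⟨2 * ca + 2 * cb, by positivity, fun f => ?_⟩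
      have e : ∑ x, (f (x * a * b) - f (x * a)) ^ 2 = ∑ x, (f (x * b) - f x) ^ 2 :=
        sum_trans (fun x => (f (x * b) - f x) ^ 2) a
      have e2 : ∑ x, (f (x * (a * b)) - f x) ^ 2 ≤
          ∑ x, (2 * (f (x * a * b) - f (x * a)) ^ 2 + 2 * (f (x * a) - f x) ^ 2) := by
        refine Finset.sum_le_sum fun x _ => ?_
        rw [← mul_assoc]
        nlinarith [sq_nonneg ((f (x * a * b) - f (x * a)) - (f (x * a) - f x))]
      rw [Finset.sum_add_distrib, ← Finset.mul_sum, ← Finset.mul_sum, e] at e2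
      linarith [ha f, hb f]
    | inv a _ iha =>
      obtain ⟨ca, ha0, ha⟩ := iha
      refine ⟨ca, ha0, fun f => ?_⟩
      refine le_trans (le_of_eq ?_) (ha f)
      rw [← sum_trans (fun x => (f (x * a⁻¹) - f x) ^ 2) a]
      refine Finset.sum_congr rfl fun x _ => ?_
      simp only [mul_inv_cancel_right]
      ring
  choose c hc0 hcf using hall
  have hn : (0 : ℝ) < Fintype.card G := by exact_mod_cast Fintype.card_pos
  have hcr : (0 : ℝ) < S.card := by exact_mod_cast hc
  set T := ∑ g, c g with hT
  have hT0 : 0 ≤ T := Finset.sum_nonneg fun g _ => hc0 g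
  refine ⟨1 / ((T + 1) * (4 * S.card)), by positivity, fun f hf => ?_⟩
  rw [lazy_quad_sub S h hc]
  have hsum : ∑ g, ∑ x, (f (x * g) - f x) ^ 2 ≤ T * dirF S f := by
    rw [hT, Finset.sum_mul]
    exact Finset.sum_le_sum fun g _ => hcf g f
  have heq : ∑ g, ∑ x, (f (x * g) - f x) ^ 2 = 2 * Fintype.card G * (f ⬝ᵥ f) := by
    rw [Finset.sum_comm]
    have : ∀ x, ∑ g, (f (x * g) - f x) ^ 2 = f ⬝ᵥ f + Fintype.card G * f x ^ 2 := by
      intro x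
      refine (Equiv.sum_comp (Equiv.mulLeft x) (fun y => (f y - f x) ^ 2)).trans ?_
      have : ∀ y, (f y - f x) ^ 2 = f y * f y - 2 * f x * f y + f x ^ 2 := fun y => by ring
      simp only [this, Finset.sum_add_distrib, Finset.sum_sub_distrib, ← Finset.mul_sum, hf]
      simp [dotProduct]
    simp only [this, Finset.sum_add_distrib, ← Finset.mul_sum]
    simp [dotProduct, sq]
    ring
  have hff : 0 ≤ f ⬝ᵥ f := by
    simp only [dotProduct]; exact Finset.sum_nonneg fun x _ => mul_self_nonneg _
  have hn1 : (1 : ℝ) ≤ Fintype.card G := by exact_mod_cast Fintype.card_pos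
  have hD := dirF_nonneg S f
  rw [div_mul_eq_mul_div, div_le_div_iff₀ (by positivity) (by positivity)]
  have : f ⬝ᵥ f ≤ (T + 1) * dirF S f := by nlinarith
  nlinarith

theorem lazy_sum (S : Finset G) (h : IsSymmGen S) (hc : 0 < S.card) (f : G → ℝ) :
    ∑ x, (lazyCayleyP S *ᵥ f) x = ∑ x, f x := by
  have hcr : (S.card : ℝ) ≠ 0 := by positivity
  simp only [lazy_mulVec S h.1, Finset.sum_add_distrib, ← Finset.sum_div]
  rw [Finset.sum_comm, Finset.sum_congr rfl (fun s _ => sum_trans f s)]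
  simp only [Finset.sum_const, nsmul_eq_mul]
  field_simp
  ring

theorem contract (S : Finset G) (h : IsSymmGen S) (hc : 0 < S.card) (γ : ℝ)
    (hg : HasGap (lazyCayleyP S) γ) (f : G → ℝ) (hf : ∑ x, f x = 0) :
    (lazyCayleyP S *ᵥ f) ⬝ᵥ (lazyCayleyP S *ᵥ f) ≤ Real.exp (-γ) * (f ⬝ᵥ f) := by
  set P := lazyCayleyP S with hPd
  have hP := lazy_psd S h hc
  have hQ := lazy_psd' S h hc
  rw [← hPd] at hP hQ
  have e1 : (P - P * P) = P * (1 - P) * P + (1 - P) * P * (1 - P) := by noncomm_ring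
  have h1 : (P - P * P).PosSemidef := by
    rw [e1]; exact (sandwich hP hQ).add (sandwich hQ hP)
  have h2 := psd_quad h1 f
  have h3 : (P *ᵥ f) ⬝ᵥ (P *ᵥ f) = f ⬝ᵥ ((P * P) *ᵥ f) := by
    rw [← Matrix.mulVec_mulVec, Matrix.dotProduct_mulVec f P, ← Matrix.mulVec_transpose,
      lazy_symm S h]
  rw [Matrix.sub_mulVec, dotProduct_sub, ← h3] at h2
  have h4 := hg f hf
  rw [Matrix.sub_mulVec, dotProduct_sub, Matrix.one_mulVec] at h4
  have hff : 0 ≤ f ⬝ᵥ f := by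
    simp only [dotProduct]; exact Finset.sum_nonneg fun x _ => mul_self_nonneg _
  have h5 := Real.add_one_le_exp (-γ)
  nlinarith

theorem contract_iter (S : Finset G) (h : IsSymmGen S) (hc : 0 < S.card) (γ : ℝ)
    (hg : HasGap (lazyCayleyP S) γ) (f : G → ℝ) (hf : ∑ x, f x = 0) (m : ℕ) :
    ∑ x, (lazyCayleyP S ^ m *ᵥ f) x = 0 ∧
    (lazyCayleyP S ^ m *ᵥ f) ⬝ᵥ (lazyCayleyP S ^ m *ᵥ f) ≤ Real.exp (-γ * m) * (f ⬝ᵥ f) := by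
  induction m with
  | zero => simp [hf]
  | succ m ih =>
    rw [pow_succ', ← Matrix.mulVec_mulVec]
    refine ⟨by rw [lazy_sum S h hc]; exact ih.1, ?_⟩
    refine (contract S h hc γ hg _ ih.1).trans ?_
    have : Real.exp (-γ * (m + 1 : ℕ)) = Real.exp (-γ) * Real.exp (-γ * m) := by
      rw [← Real.exp_add]; push_cast; ring_nf
    rw [this, mul_assoc]
    exact mul_le_mul_of_nonneg_left ih.2 (Real.exp_pos _).le

theorem mix_of_gap (S : Finset G) (h : IsSymmGen S) (hc : 0 < S.card) (γ : ℝ)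
    (hg : HasGap (lazyCayleyP S) γ) (m : ℕ)
    (hm : (Fintype.card G : ℝ) * Real.exp (-γ * m) ≤ 1 / 4) (x : G) :
    (∑ y : G, |(lazyCayleyP S ^ m) x y - 1 / (Fintype.card G : ℝ)|) / 2 ≤ 1 / 4 := by
  have hn : (0 : ℝ) < Fintype.card G := by exact_mod_cast Fintype.card_pos
  set n : ℝ := (Fintype.card G : ℝ) with hnd
  set f : G → ℝ := fun y => (if y = x then 1 else 0) - 1 / n with hfd
  have hf : ∑ y, f y = 0 := by
    simp only [hfd, Finset.sum_sub_distrib]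
    simp
    rw [← hnd]
    field_simp
    ring
  have hff : f ⬝ᵥ f ≤ 1 := by
    have : f ⬝ᵥ f = 1 - 1 / n := by
      have e : ∀ y, f y * f y = (if y = x then (1 - 2 / n) else 0) + 1 / n ^ 2 := by
        intro y
        simp only [hfd]
        split_ifs <;> field_simp <;> ring
      simp only [dotProduct, e, Finset.sum_add_distrib]
      simp
      rw [← hnd]
      field_simp
      ring
    rw [this]
    have : 0 < 1 / n := by positivity
    linarith
  have hsymm : ∀ y, (lazyCayleyP S ^ m) y x = (lazyCayleyP S ^ m) x y := by
    intro y
    have : (lazyCayleyP S ^ m)ᵀ = lazyCayleyP S ^ m := by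
      rw [Matrix.transpose_pow, lazy_symm S h]
    conv_lhs => rw [← this]
    rfl
  have hone : ∀ k : ℕ, lazyCayleyP S ^ k *ᵥ (fun _ => (1 / n : ℝ)) = fun _ => 1 / n := by
    intro k
    induction k with
    | zero => simp
    | succ k ih =>
      rw [pow_succ', ← Matrix.mulVec_mulVec, ih]
      ext y
      have hcr : (S.card : ℝ) ≠ 0 := by positivity
      rw [lazy_mulVec S h.1]
      simp only [Finset.sum_const, nsmul_eq_mul]
      field_simp
      ring
  have hval : ∀ y, (lazyCayleyP S ^ m *ᵥ f) y = (lazyCayleyP S ^ m) x y - 1 / n := by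
    intro y
    have e : f = (Pi.single x 1 : G → ℝ) - fun _ => 1 / n := by
      ext y; simp [hfd, Pi.single_apply]
    rw [e, Matrix.mulVec_sub, hone, Pi.sub_apply, Matrix.mulVec_single_one, ← hsymm y]
    rfl
  have h1 := (contract_iter S h hc γ hg f hf m).2
  have h2 : (∑ y : G, |(lazyCayleyP S ^ m) x y - 1 / n|) ^ 2 ≤
      n * ∑ y, |(lazyCayleyP S ^ m) x y - 1 / n| ^ 2 := by
    have := sq_sum_le_card_mul_sum_sq (s := (Finset.univ : Finset G))
      (f := fun y => |(lazyCayleyP S ^ m) x y - 1 / n|)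
    simpa [Finset.card_univ, hnd] using this
  have h3 : ∑ y, |(lazyCayleyP S ^ m) x y - 1 / n| ^ 2 =
      (lazyCayleyP S ^ m *ᵥ f) ⬝ᵥ (lazyCayleyP S ^ m *ᵥ f) := by
    simp only [dotProduct, hval, sq_abs]
    exact Finset.sum_congr rfl fun y _ => by ring
  rw [h3] at h2
  have hE := Real.exp_pos (-γ * m)
  have h4 : (∑ y : G, |(lazyCayleyP S ^ m) x y - 1 / n|) ^ 2 ≤ 1 / 4 := by
    calc _ ≤ n * (Real.exp (-γ * m) * (f ⬝ᵥ f)) := h2.trans (by gcongr)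
      _ ≤ n * (Real.exp (-γ * m) * 1) := by gcongr
      _ ≤ 1 / 4 := by simpa using hm
  have h5 : ∑ y : G, |(lazyCayleyP S ^ m) x y - 1 / n| ≤ 1 / 2 := by
    by_contra hh
    push Not at hh
    nlinarith
  linarith

end Helpers


open Finset

/-- If `S ⊆ S' ⊆ Sⁱ` and `|S'| ≤ K|S|`, then
`mix(Cay(Γ,S')) ≤ C(i,K) · mix(Cay(Γ,S)) · log |Γ|`. -/
theorem mixing_comparison_log_bound (i : ℕ) (hi : 1 ≤ i) (K : ℝ) (hK : 1 ≤ K) :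
    ∃ C > (0 : ℝ), ∀ (G : Type) [Group G] [Fintype G] [DecidableEq G],
      ∀ S S' : Finset G, 2 ≤ Fintype.card G →
        IsSymmGen S → IsSymmGen S' → S ⊆ S' → (S' : Set G) ⊆ prodPow S i →
        (S'.card : ℝ) ≤ K * (S.card : ℝ) →
        (tvMixUnif (lazyCayleyP S') : ℝ) ≤
          C * (tvMixUnif (lazyCayleyP S) : ℝ) * Real.log (Fintype.card G : ℝ) := by
  refine ⟨6 * K + 2, by linarith, ?_⟩
  intro G _ _ _ S S' hcard h h' hsub _ hKc
  have hc : 0 < S.card := by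
    rw [Finset.card_pos]
    by_contra hne
    rw [Finset.not_nonempty_iff_eq_empty] at hne
    have h2 := h.2.2
    rw [hne] at h2
    simp only [Finset.coe_empty, Subgroup.closure_empty] at h2
    have hnt : Nontrivial G := Fintype.one_lt_card_iff_nontrivial.mp (by omega)
    exact bot_ne_top h2
  have hc' : 0 < S'.card := lt_of_lt_of_le hc (Finset.card_le_card hsub)
  have hn2 : (2 : ℝ) ≤ Fintype.card G := by exact_mod_cast hcard
  have hn0 : (0 : ℝ) < Fintype.card G := by linarith
  have hlog2 : Real.log 2 ≤ Real.log (Fintype.card G : ℝ) := Real.log_le_log (by norm_num) hn2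
  have hl2 := Real.log_two_gt_d9
  have hlog4 : Real.log 4 = 2 * Real.log 2 := by
    rw [show (4 : ℝ) = 2 ^ 2 by norm_num, Real.log_pow]; norm_num
  have hgood : ∀ (γ : ℝ) (m : ℕ), 3 * Real.log (Fintype.card G : ℝ) ≤ γ * m →
      (Fintype.card G : ℝ) * Real.exp (-γ * m) ≤ 1 / 4 := by
    intro γ m hm
    have e1 : Real.exp (-γ * m) ≤
        Real.exp (-(Real.log (Fintype.card G : ℝ) + Real.log 4)) :=
      Real.exp_le_exp.mpr (by linarith)
    rw [neg_add, Real.exp_add, Real.exp_neg, Real.exp_neg, Real.exp_log hn0,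
      Real.exp_log (by norm_num)] at e1
    calc _ ≤ (Fintype.card G : ℝ) * ((Fintype.card G : ℝ)⁻¹ * 4⁻¹) := by gcongr
      _ = 1 / 4 := by field_simp
  -- the mixing time of `S` is attained
  have hne : {t : ℕ | ∀ x : G, (∑ y : G, |(lazyCayleyP S ^ t) x y
      - 1 / (Fintype.card G : ℝ)|) / 2 ≤ 1 / 4}.Nonempty := by
    obtain ⟨γ, hγ, hg⟩ := gap_exists S h hc
    refine ⟨⌈3 * Real.log (Fintype.card G : ℝ) / γ⌉₊, fun x => ?_⟩
    refine mix_of_gap S h hc γ hg _ (hgood _ _ ?_) x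
    have := Nat.le_ceil (3 * Real.log (Fintype.card G : ℝ) / γ)
    rw [div_le_iff₀ hγ] at this
    linarith
  have hmem := Nat.sInf_mem hne
  change tvMixUnif (lazyCayleyP S) ∈ _ at hmem
  set t := tvMixUnif (lazyCayleyP S) with htd
  have ht : 0 < t := by
    rcases Nat.eq_zero_or_pos t with h0 | h0
    · exfalso
      rw [h0] at hmem
      have h1 := hmem 1
      have h2 := Finset.single_le_sum
        (f := fun y : G => |(lazyCayleyP S ^ 0) 1 y - 1 / (Fintype.card G : ℝ)|)
        (fun _ _ => abs_nonneg _) (Finset.mem_univ (1 : G))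
      have h3 : ∑ y : G, ((lazyCayleyP S ^ 0) 1 y - 1 / (Fintype.card G : ℝ)) = 0 := by
        simp [Finset.sum_sub_distrib, Matrix.one_apply]
      have hu : ∀ y : G, (lazyCayleyP S ^ 0) 1 y = if (1 : G) = y then 1 else 0 := by
        intro y; simp [Matrix.one_apply]
      have h4 : ∑ y : G, ((if (1 : G) = y then 2 * (1 - 1 / (Fintype.card G : ℝ)) else 0)
          - ((lazyCayleyP S ^ 0) 1 y - 1 / (Fintype.card G : ℝ)))
          ≤ ∑ y : G, |(lazyCayleyP S ^ 0) 1 y - 1 / (Fintype.card G : ℝ)| := by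
        refine Finset.sum_le_sum fun y _ => ?_
        rw [hu y]
        split_ifs
        · refine le_trans (le_of_eq ?_) (le_abs_self _); ring
        · refine le_trans (le_of_eq ?_) (neg_le_abs _); ring
      rw [Finset.sum_sub_distrib, h3] at h4
      simp only [Finset.sum_ite_eq, Finset.mem_univ, if_true] at h4
      have h5 : 1 / (Fintype.card G : ℝ) ≤ 1 / 2 :=
        one_div_le_one_div_of_le (by norm_num) hn2
      linarith
    · exact h0
  have ht1 : (1 : ℝ) ≤ t := by exact_mod_cast ht
  have hg := gap_of_mix (lazy_psd S h hc) (lazy_psd' S h hc) t ht hmem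
  have hg' := gap_compare S S' h h' hc hsub K hK hKc _ hg
  set L := Real.log (Fintype.card G : ℝ) with hL
  have hle : tvMixUnif (lazyCayleyP S') ≤ ⌈6 * K * t * L⌉₊ := by
    refine Nat.sInf_le fun x => ?_
    refine mix_of_gap S' h' hc' _ hg' _ (hgood _ _ ?_) x
    have h1 := Nat.le_ceil (6 * K * t * L)
    have hK0 : 0 < K := by linarith
    rw [div_div, div_mul_eq_mul_div, le_div_iff₀ (by positivity)]
    linarith
  have hL0 : 1 / 2 ≤ L := by linarith
  have hnn : 0 ≤ 6 * K * t * L := by positivity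
  have h1 := (Nat.ceil_lt_add_one hnn).le
  have h2 : (tvMixUnif (lazyCayleyP S') : ℝ) ≤ (⌈6 * K * t * L⌉₊ : ℝ) := by exact_mod_cast hle
  nlinarith
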